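/- If N has at least 3 agents, then no rule on the domain of mixed lexicographic housing markets (profiles in which each agent's preference is either strict demand lexicographic or strict supply lexicographic) satisfies individual rationality, pair efficiency, and strategy-proofness. -/

import Mathlib

open Classical Function

/-- A strict linear order on `N`: `pref h h'` means `h` is strictly preferred to `h'`. -/
structure SLO (N : Type*) where
  pref : N → N → Prop
  trichotomous : ∀ a b, pref a b ∨ a = b ∨ pref b a
  irrefl : ∀ a, ¬ pref a a
  trans : ∀ a b c, pref a b → pref b c → pref a c

/-- A mixed lexicographic preference: strict demand and supply orders, compared
lexicographically demand-first if `demandFirst = true` (strict demand lexicographic),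
and supply-first otherwise (strict supply lexicographic). -/
structure MixedLexPref (N : Type*) where
  dem : SLO N
  sup : SLO N
  demandFirst : Bool

variable {N : Type*}

/-- `a ≻ᵢ b` for mixed lexicographic preferences. -/
def MixedLexPref.SPref (P : MixedLexPref N) (i : N) (a b : Equiv.Perm N) : Prop :=
  if P.demandFirst then
    P.dem.pref (a i) (b i) ∨ (a i = b i ∧ P.sup.pref (a.symm i) (b.symm i))
  else
    P.sup.pref (a.symm i) (b.symm i) ∨ (a.symm i = b.symm i ∧ P.dem.pref (a i) (b i))

/-- `a ≽ᵢ b` for mixed lexicographic preferences. -/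
def MixedLexPref.WPref (P : MixedLexPref N) (i : N) (a b : Equiv.Perm N) : Prop :=
  P.SPref i a b ∨ (a i = b i ∧ a.symm i = b.symm i)

section MProps
variable [DecidableEq N]

/-- `a` is individually rational at the mixed market `P`. -/
def MIndRational (P : N → MixedLexPref N) (a : Equiv.Perm N) : Prop :=
  ∀ i : N, (P i).WPref i a 1

/-- `b` Pareto dominates `a` at the mixed market `P`. -/
def MParetoDom (P : N → MixedLexPref N) (b a : Equiv.Perm N) : Prop :=
  (∀ i : N, (P i).WPref i b a) ∧ ∃ j : N, (P j).SPref j b a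

/-- `a` is Pareto efficient at the mixed market `P`. -/
def MParetoEff (P : N → MixedLexPref N) (a : Equiv.Perm N) : Prop :=
  ¬ ∃ b : Equiv.Perm N, MParetoDom P b a

/-- `a` is pair efficient at the mixed market `P`. -/
def MPairEff (P : N → MixedLexPref N) (a : Equiv.Perm N) : Prop :=
  ¬ ∃ i j : N, i ≠ j ∧ (P i).SPref i (a * Equiv.swap i j) a ∧
    (P j).SPref j (a * Equiv.swap i j) a ∧ MParetoDom P (a * Equiv.swap i j) a

/-- `a` is pairwise stable at the mixed market `P`. -/
def MPairwiseStable (P : N → MixedLexPref N) (a : Equiv.Perm N) : Prop :=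
  ¬ ∃ i j : N, i ≠ j ∧ (P i).SPref i (a * Equiv.swap i j) a ∧
    (P j).SPref j (a * Equiv.swap i j) a

end MProps

/-- The rank of a house in an order whose top elements are `p`, `q`, `r`, in this order,
the others being ranked by an enumeration. -/
noncomputable def topRank [Fintype N] [DecidableEq N] (p q r n : N) : ℕ :=
  if n = p then 0 else if n = q then 1 else if n = r then 2 else Fintype.equivFin N n + 3

theorem topRank_injective [Fintype N] [DecidableEq N] (p q r : N) :
    Injective (topRank p q r) := by
  intro m n h
  by_contra hmn
  have he : (Fintype.equivFin N m : ℕ) ≠ Fintype.equivFin N n := fun he =>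
    hmn ((Fintype.equivFin N).injective (Fin.ext he))
  unfold topRank at h
  split_ifs at h <;> first | omega | simp_all

/-- A strict linear order whose top elements are `p`, `q`, `r`, in this order. -/
noncomputable def SLO.top [Fintype N] [DecidableEq N] (p q r : N) : SLO N where
  pref m n := topRank p q r m < topRank p q r n
  trichotomous _ _ := (lt_trichotomy _ _).imp_right (Or.imp_left (topRank_injective p q r ·))
  irrefl _ := lt_irrefl _
  trans _ _ _ := lt_trans

/-- A pair efficient allocation admits no swap of `a i` and `a j` that is strictly better
for `i` and `j` and weakly better for the owners of the swapped houses. -/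
theorem MPairEff.false_of_swap [DecidableEq N] {P : N → MixedLexPref N} {a : Equiv.Perm N}
    (h : MPairEff P a) {i j : N} (hij : i ≠ j)
    (hi : (P i).SPref i (a * Equiv.swap i j) a) (hj : (P j).SPref j (a * Equiv.swap i j) a)
    (hai : (P (a i)).WPref (a i) (a * Equiv.swap i j) a)
    (haj : (P (a j)).WPref (a j) (a * Equiv.swap i j) a) : False := by
  refine h ⟨i, j, hij, hi, hj, fun k => ?_, i, hi⟩
  by_cases h₁ : k = i
  · rw [h₁]
    exact Or.inl hi
  by_cases h₂ : k = j
  · rw [h₂]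
    exact Or.inl hj
  by_cases h₃ : k = a i
  · exact h₃ ▸ hai
  by_cases h₄ : k = a j
  · exact h₄ ▸ haj
  refine Or.inr ⟨by simp [Equiv.swap_apply_of_ne_of_ne h₁ h₂], ?_⟩
  have h₅ : a.symm k ≠ i := fun h => h₃ (by simp [← h])
  have h₆ : a.symm k ≠ j := fun h => h₄ (by simp [← h])
  rw [Equiv.symm_apply_eq]
  simp [Equiv.swap_apply_of_ne_of_ne h₅ h₆]

/-- A permutation fixing everything but three points is one of six permutations. -/
theorem perm_cases_of_fixes {x y z : N} (hxy : x ≠ y) (hxz : x ≠ z) (hyz : y ≠ z)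
    (a : Equiv.Perm N) (ha : ∀ k, k ≠ x → k ≠ y → k ≠ z → a k = k) :
    (a x = x ∧ a y = y ∧ a z = z) ∨ (a x = y ∧ a y = x ∧ a z = z) ∨
    (a x = z ∧ a y = y ∧ a z = x) ∨ (a x = x ∧ a y = z ∧ a z = y) ∨
    (a x = y ∧ a y = z ∧ a z = x) ∨ (a x = z ∧ a y = x ∧ a z = y) := by
  have key : ∀ w, w = x ∨ w = y ∨ w = z → a w = x ∨ a w = y ∨ a w = z := by
    intro w hw
    by_contra! h
    have := a.injective (ha _ h.1 h.2.1 h.2.2)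
    rw [this] at h
    tauto
  have h₁ : a x ≠ a y := a.injective.ne hxy
  have h₂ : a x ≠ a z := a.injective.ne hxz
  have h₃ : a y ≠ a z := a.injective.ne hyz
  rcases key x (by simp) with h | h | h <;> rcases key y (by simp) with h' | h' | h' <;>
    rcases key z (by simp) with h'' | h'' | h'' <;> simp_all

/-- The market in which `x`, `y`, `z` have the preferences `X`, `Y`, `Z` and every other agent
likes her own house best. -/
noncomputable def triMarket [Fintype N] [DecidableEq N] (x y z : N) (X Y Z : MixedLexPref N) :
    N → MixedLexPref N := fun k =>
  if k = x then X else if k = y then Y else if k = z then Z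
  else ⟨SLO.top k k k, SLO.top k k k, true⟩

theorem MIndRational.triMarket_fixes [Fintype N] [DecidableEq N] {x y z : N}
    {X Y Z : MixedLexPref N} {a : Equiv.Perm N} (h : MIndRational (triMarket x y z X Y Z) a)
    (k : N) (hx : k ≠ x) (hy : k ≠ y) (hz : k ≠ z) : a k = k := by
  have := h k
  simp only [MixedLexPref.WPref, MixedLexPref.SPref, triMarket, hx, hy, hz, SLO.top, topRank]
    at this
  simp at this
  tauto

section Markets

attribute [local simp] MixedLexPref.WPref MixedLexPref.SPref triMarket SLO.top topRank
  Equiv.Perm.mul_def Equiv.Perm.one_def Equiv.swap_apply_of_ne_of_ne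

variable [Fintype N] [DecidableEq N] {x y z : N} {a : Equiv.Perm N}

/-- The supply lexicographic preference of `x` accepting every exchange. -/
noncomputable abbrev prefX (x y z : N) : MixedLexPref N := ⟨SLO.top x z y, SLO.top z y x, false⟩

/-- The demand lexicographic preference of `x` accepting only the house of `z`. -/
noncomputable abbrev prefX' (x y z : N) : MixedLexPref N := ⟨SLO.top z x y, SLO.top x y z, true⟩

/-- The supply lexicographic preference of `y` accepting only to give her house to `x`. -/
noncomputable abbrev prefY (x y z : N) : MixedLexPref N := ⟨SLO.top y z x, SLO.top x y z, false⟩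

/-- The demand lexicographic preference of `z` accepting only the house of `x`. -/
noncomputable abbrev prefZ (x y z : N) : MixedLexPref N := ⟨SLO.top x z y, SLO.top y x z, true⟩

/-- The supply lexicographic preference of `z` accepting only to give her house to `y`. -/
noncomputable abbrev prefZ' (x y z : N) : MixedLexPref N := ⟨SLO.top y x z, SLO.top y z x, false⟩

set_option linter.unusedSimpArgs false in
theorem triMarket_cycle_or_swap (hxy : x ≠ y) (hxz : x ≠ z) (hyz : y ≠ z)
    (hir : MIndRational (triMarket x y z (prefX x y z) (prefY x y z) (prefZ x y z)) a)
    (hpe : MPairEff (triMarket x y z (prefX x y z) (prefY x y z) (prefZ x y z)) a) :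
    (a x = y ∧ a y = z ∧ a z = x) ∨ (a x = z ∧ a y = y ∧ a z = x) := by
  have hy := hir y
  rcases perm_cases_of_fixes hxy hxz hyz a hir.triMarket_fixes with
    ⟨h₁, h₂, h₃⟩ | ⟨h₁, h₂, h₃⟩ | ⟨h₁, h₂, h₃⟩ | ⟨h₁, h₂, h₃⟩ | ⟨h₁, h₂, h₃⟩ | ⟨h₁, h₂, h₃⟩ <;>
  have s₁ := (Equiv.symm_apply_eq a).2 h₁.symm <;>
  have s₂ := (Equiv.symm_apply_eq a).2 h₂.symm <;>
  have s₃ := (Equiv.symm_apply_eq a).2 h₃.symm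
  · refine (hpe.false_of_swap hxz ?_ ?_ ?_ ?_).elim <;>
      simp [h₁, h₂, h₃, s₁, s₂, s₃, hxy, hxz, hyz, hxy.symm, hxz.symm, hyz.symm]
  · refine (hpe.false_of_swap hyz ?_ ?_ ?_ ?_).elim <;>
      simp [h₁, h₂, h₃, s₁, s₂, s₃, hxy, hxz, hyz, hxy.symm, hxz.symm, hyz.symm]
  · exact Or.inr ⟨h₁, h₂, h₃⟩
  · simp [h₁, h₂, h₃, s₁, s₂, s₃, hxy, hxz, hyz, hxy.symm, hxz.symm, hyz.symm] at hy
  · exact Or.inl ⟨h₁, h₂, h₃⟩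
  · simp [h₁, h₂, h₃, s₁, s₂, s₃, hxy, hxz, hyz, hxy.symm, hxz.symm, hyz.symm] at hy

set_option linter.unusedSimpArgs false in
theorem triMarket_cycle (hxy : x ≠ y) (hxz : x ≠ z) (hyz : y ≠ z)
    (hir : MIndRational (triMarket x y z (prefX x y z) (prefY x y z) (prefZ' x y z)) a)
    (hpe : MPairEff (triMarket x y z (prefX x y z) (prefY x y z) (prefZ' x y z)) a) :
    a x = y ∧ a y = z ∧ a z = x := by
  have hy := hir y
  have hz := hir z
  rcases perm_cases_of_fixes hxy hxz hyz a hir.triMarket_fixes with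
    ⟨h₁, h₂, h₃⟩ | ⟨h₁, h₂, h₃⟩ | ⟨h₁, h₂, h₃⟩ | ⟨h₁, h₂, h₃⟩ | ⟨h₁, h₂, h₃⟩ | ⟨h₁, h₂, h₃⟩ <;>
  have s₁ := (Equiv.symm_apply_eq a).2 h₁.symm <;>
  have s₂ := (Equiv.symm_apply_eq a).2 h₂.symm <;>
  have s₃ := (Equiv.symm_apply_eq a).2 h₃.symm
  · refine (hpe.false_of_swap hxy ?_ ?_ ?_ ?_).elim <;>
      simp [h₁, h₂, h₃, s₁, s₂, s₃, hxy, hxz, hyz, hxy.symm, hxz.symm, hyz.symm]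
  · refine (hpe.false_of_swap hyz ?_ ?_ ?_ ?_).elim <;>
      simp [h₁, h₂, h₃, s₁, s₂, s₃, hxy, hxz, hyz, hxy.symm, hxz.symm, hyz.symm]
  · simp [h₁, h₂, h₃, s₁, s₂, s₃, hxy, hxz, hyz, hxy.symm, hxz.symm, hyz.symm] at hz
  · simp [h₁, h₂, h₃, s₁, s₂, s₃, hxy, hxz, hyz, hxy.symm, hxz.symm, hyz.symm] at hy
  · exact ⟨h₁, h₂, h₃⟩
  · simp [h₁, h₂, h₃, s₁, s₂, s₃, hxy, hxz, hyz, hxy.symm, hxz.symm, hyz.symm] at hy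

set_option linter.unusedSimpArgs false in
theorem triMarket_swap (hxy : x ≠ y) (hxz : x ≠ z) (hyz : y ≠ z)
    (hir : MIndRational (triMarket x y z (prefX' x y z) (prefY x y z) (prefZ x y z)) a)
    (hpe : MPairEff (triMarket x y z (prefX' x y z) (prefY x y z) (prefZ x y z)) a) :
    a x = z ∧ a y = y ∧ a z = x := by
  have hx := hir x
  have hy := hir y
  rcases perm_cases_of_fixes hxy hxz hyz a hir.triMarket_fixes with
    ⟨h₁, h₂, h₃⟩ | ⟨h₁, h₂, h₃⟩ | ⟨h₁, h₂, h₃⟩ | ⟨h₁, h₂, h₃⟩ | ⟨h₁, h₂, h₃⟩ | ⟨h₁, h₂, h₃⟩ <;>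
  have s₁ := (Equiv.symm_apply_eq a).2 h₁.symm <;>
  have s₂ := (Equiv.symm_apply_eq a).2 h₂.symm <;>
  have s₃ := (Equiv.symm_apply_eq a).2 h₃.symm
  · refine (hpe.false_of_swap hxz ?_ ?_ ?_ ?_).elim <;>
      simp [h₁, h₂, h₃, s₁, s₂, s₃, hxy, hxz, hyz, hxy.symm, hxz.symm, hyz.symm]
  · simp [h₁, h₂, h₃, s₁, s₂, s₃, hxy, hxz, hyz, hxy.symm, hxz.symm, hyz.symm] at hx
  · exact ⟨h₁, h₂, h₃⟩
  · simp [h₁, h₂, h₃, s₁, s₂, s₃, hxy, hxz, hyz, hxy.symm, hxz.symm, hyz.symm] at hy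
  · simp [h₁, h₂, h₃, s₁, s₂, s₃, hxy, hxz, hyz, hxy.symm, hxz.symm, hyz.symm] at hx
  · simp [h₁, h₂, h₃, s₁, s₂, s₃, hxy, hxz, hyz, hxy.symm, hxz.symm, hyz.symm] at hy

end Markets

theorem update_triMarket_fst [Fintype N] [DecidableEq N] (x y z : N) (X X' Y Z : MixedLexPref N) :
    update (triMarket x y z X Y Z) x X' = triMarket x y z X' Y Z := by
  funext k
  by_cases h : k = x <;> simp [triMarket, h]

theorem update_triMarket_thd [Fintype N] [DecidableEq N] {x y z : N} (hxz : x ≠ z) (hyz : y ≠ z)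
    (X Y Z Z' : MixedLexPref N) :
    update (triMarket x y z X Y Z) z Z' = triMarket x y z X Y Z' := by
  funext k
  by_cases h : k = z <;> simp [triMarket, h, hxz.symm, hyz.symm]

/-- If there are at least three agents, no rule on the domain of mixed
lexicographic markets is individually rational, pair efficient and strategy-proof. -/
theorem mixed_impossibility_pairEfficiency {N : Type*} [Fintype N] [DecidableEq N]
    (hN : 3 ≤ Fintype.card N) (φ : (N → MixedLexPref N) → Equiv.Perm N) :
    ¬ ((∀ P, MIndRational P (φ P)) ∧ (∀ P, MPairEff P (φ P)) ∧
        (∀ (P : N → MixedLexPref N) (i : N) (P' : MixedLexPref N),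
          (P i).WPref i (φ P) (φ (Function.update P i P')))) := by
  rintro ⟨hir, hpe, hsp⟩
  obtain ⟨x, y, z, hxy, hxz, hyz⟩ := Fintype.two_lt_card_iff.1 hN
  rcases triMarket_cycle_or_swap hxy hxz hyz (hir _) (hpe _) with ⟨h₁, h₂, h₃⟩ | ⟨h₁, h₂, h₃⟩
  · have h := hsp (triMarket x y z (prefX x y z) (prefY x y z) (prefZ x y z)) x (prefX' x y z)
    rw [update_triMarket_fst] at h
    obtain ⟨k₁, -, k₃⟩ := triMarket_swap hxy hxz hyz (hir _) (hpe _)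
    simp [MixedLexPref.WPref, MixedLexPref.SPref, triMarket, SLO.top, topRank, h₁,
      (Equiv.symm_apply_eq _).2 h₃.symm, k₁, (Equiv.symm_apply_eq _).2 k₃.symm,
      hxy.symm, hxz.symm, hyz] at h
  · have h := hsp (triMarket x y z (prefX x y z) (prefY x y z) (prefZ x y z)) z (prefZ' x y z)
    rw [update_triMarket_thd hxz hyz] at h
    obtain ⟨-, k₂, k₃⟩ := triMarket_cycle hxy hxz hyz (hir _) (hpe _)
    simp [MixedLexPref.WPref, MixedLexPref.SPref, triMarket, SLO.top, topRank, h₃,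
      (Equiv.symm_apply_eq _).2 h₁.symm, k₃, (Equiv.symm_apply_eq _).2 k₂.symm,
      hxy, hxz.symm, hyz.symm] at h
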